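/- Fix N ≥ 1, 0 < b < min{2,N}, p > 1, and let u be a classical Schwartz solution of (INLS) on an interval J. Let φ : ℝ^N → ℝ be of class C⁴ with each partial derivative of φ of order ≤ 4 bounded by C(1+|x|)^m for some constants C, m. Then the localized virial quantity I(t) = ∫_{ℝ^N} φ(x)|u(t,x)|² dx is differentiable on J with I'(t) = 2 Im ∫_{ℝ^N} ∇φ(x)·∇ₓu(t,x) · conj(u(t,x)) dx. -/

import Mathlib

open MeasureTheory Set
open scoped BigOperators

noncomputable section

/-- The Laplacian of a complex-valued function on `ℝ^N`, computed as the sum of the repeated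
directional derivatives along the standard basis vectors. -/
def lap {N : ℕ} (f : EuclideanSpace ℝ (Fin N) → ℂ) (x : EuclideanSpace ℝ (Fin N)) : ℂ :=
  ∑ i : Fin N, fderiv ℝ (fun y => fderiv ℝ f y (EuclideanSpace.single i 1)) x
      (EuclideanSpace.single i 1)

/-- The squared euclidean norm `|∇f(x)|²` of the gradient of `f : ℝ^N → ℂ` at `x`. -/
def gradNormSq {N : ℕ} (f : EuclideanSpace ℝ (Fin N) → ℂ) (x : EuclideanSpace ℝ (Fin N)) : ℝ :=
  ∑ i : Fin N, ‖fderiv ℝ f x (EuclideanSpace.single i 1)‖ ^ 2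

/-- A classical Schwartz solution of the inhomogeneous nonlinear Schrödinger equation
`i ∂ₜ u + Δu + |x|^{-b} |u|^{p-1} u = 0` on a time interval `J`:
for each time `t` the spatial profile `u t` is a Schwartz function, `u` is jointly
continuous on `J × ℝ^N`, jointly smooth on `J × (ℝ^N \ {0})`, the Schwartz seminorms of
`u t` are bounded uniformly for `t` in compact subsets of `J`, and the equation holds for
all `t ∈ J` and `x ≠ 0`. -/
structure INLSSolution (N : ℕ) (b p : ℝ) (J : Set ℝ) where
  u : ℝ → SchwartzMap (EuclideanSpace ℝ (Fin N)) ℂ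
  cont : ContinuousOn (fun q : ℝ × EuclideanSpace ℝ (Fin N) => u q.1 q.2) (J ×ˢ univ)
  smooth : ContDiffOn ℝ (⊤ : ℕ∞) (fun q : ℝ × EuclideanSpace ℝ (Fin N) => u q.1 q.2)
      (J ×ˢ {x : EuclideanSpace ℝ (Fin N) | x ≠ 0})
  seminorm_bound : ∀ K : Set ℝ, K ⊆ J → IsCompact K → ∀ k n : ℕ,
      ∃ C : ℝ, ∀ t ∈ K, SchwartzMap.seminorm ℝ k n (u t) ≤ C
  eqn : ∀ t ∈ J, ∀ x : EuclideanSpace ℝ (Fin N), x ≠ 0 → ∃ ut' : ℂ,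
      HasDerivWithinAt (fun s => u s x) ut' J t ∧
      Complex.I * ut' + lap (fun y => u t y) x +
        ((‖x‖ ^ (-b) * ‖u t x‖ ^ (p - 1) : ℝ) : ℂ) * u t x = 0

open Filter Topology
open scoped SchwartzMap LineDeriv

/-- Differentiation under the integral sign within a convex set of parameters. -/
lemma hasDerivWithinAt_integral_of_dominated {α : Type*} [MeasurableSpace α] {μ : Measure α}
    {F F' : ℝ → α → ℝ} {K : Set ℝ} (hK : Convex ℝ K) {t : ℝ} (ht : t ∈ K)
    (hF : ∀ s ∈ K, Integrable (F s) μ) {bound : α → ℝ} (hbound : Integrable bound μ)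
    (hF' : ∀ᵐ x ∂μ, ∀ s ∈ K, HasDerivWithinAt (fun r => F r x) (F' s x) K s ∧
      ‖F' s x‖ ≤ bound x) :
    HasDerivWithinAt (fun s => ∫ x, F s x ∂μ) (∫ x, F' t x ∂μ) K t := by
  rw [hasDerivWithinAt_iff_tendsto_slope]
  have hmem : ∀ᶠ s in 𝓝[K \ {t}] t, s ∈ K \ {t} := self_mem_nhdsWithin
  have key : Tendsto (fun s => ∫ x, slope (fun r => F r x) t s ∂μ) (𝓝[K \ {t}] t)
      (𝓝 (∫ x, F' t x ∂μ)) := by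
    refine tendsto_integral_filter_of_dominated_convergence bound ?_ ?_ hbound ?_
    · filter_upwards [hmem] with s hs
      simp only [slope_def_field]
      exact (((hF s hs.1).sub (hF t ht)).div_const _).aestronglyMeasurable
    · filter_upwards [hmem] with s hs
      filter_upwards [hF'] with x hx
      have h := hK.norm_image_sub_le_of_norm_hasDerivWithin_le (fun r hr => (hx r hr).1)
        (fun r hr => (hx r hr).2) ht hs.1
      rw [slope_def_field, norm_div, div_le_iff₀ (norm_pos_iff.2 (sub_ne_zero.2 hs.2))]
      exact h
    · filter_upwards [hF'] with x hx
      exact hasDerivWithinAt_iff_tendsto_slope.1 (hx t ht).1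
  refine key.congr' ?_
  filter_upwards [hmem] with s hs
  simp only [slope_def_field]
  rw [integral_div, integral_sub (hF s hs.1) (hF t ht)]

/-- Every point of an interval has a relative neighbourhood that is a compact interval. -/
lemma Set.OrdConnected.exists_Icc_mem_nhdsWithin {J : Set ℝ} (hJ : J.OrdConnected) {t : ℝ}
    (ht : t ∈ J) : ∃ a c, t ∈ Icc a c ∧ Icc a c ⊆ J ∧ Icc a c ∈ 𝓝[J] t := by
  obtain ⟨a, haJ, hat, ha⟩ : ∃ a ∈ J, a ≤ t ∧ ∀ᶠ s in 𝓝[J] t, a ≤ s := by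
    by_cases h : ∃ a ∈ J, a < t
    · obtain ⟨a, haJ, hat⟩ := h
      exact ⟨a, haJ, hat.le, nhdsWithin_le_nhds (eventually_ge_nhds hat)⟩
    · push Not at h
      exact ⟨t, ht, le_rfl, eventually_mem_nhdsWithin.mono h⟩
  obtain ⟨c, hcJ, htc, hc⟩ : ∃ c ∈ J, t ≤ c ∧ ∀ᶠ s in 𝓝[J] t, s ≤ c := by
    by_cases h : ∃ c ∈ J, t < c
    · obtain ⟨c, hcJ, htc⟩ := h
      exact ⟨c, hcJ, htc.le, nhdsWithin_le_nhds (eventually_le_nhds htc)⟩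
    · push Not at h
      exact ⟨t, ht, le_rfl, eventually_mem_nhdsWithin.mono h⟩
  exact ⟨a, c, ⟨hat, htc⟩, hJ.out haJ hcJ, ha.and hc⟩

/-- Uniform seminorm bounds on a family of Schwartz functions give uniform decay. -/
lemma SchwartzMap.exists_forall_one_add_norm_pow_mul_le {ι E F : Type*}
    [NormedAddCommGroup E] [NormedSpace ℝ E] [NormedAddCommGroup F] [NormedSpace ℝ F]
    {f : ι → 𝓢(E, F)} {K : Set ι}
    (h : ∀ k n : ℕ, ∃ C : ℝ, ∀ s ∈ K, SchwartzMap.seminorm ℝ k n (f s) ≤ C) (k n : ℕ) :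
    ∃ C : ℝ, 0 ≤ C ∧ ∀ s ∈ K, ∀ x, (1 + ‖x‖) ^ k * ‖iteratedFDeriv ℝ n (f s) x‖ ≤ C := by
  choose C hC using h
  refine ⟨2 ^ k * ∑ m ∈ Finset.Iic (k, n), |C m.1 m.2|, by positivity, fun s hs x => ?_⟩
  refine (one_add_le_sup_seminorm_apply (𝕜 := ℝ) (m := (k, n)) le_rfl le_rfl (f s) x).trans ?_
  gcongr
  refine Seminorm.finset_sup_apply_le (by positivity) fun m hm => ?_
  exact (hC m.1 m.2 s hs).trans ((le_abs_self _).trans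
    (Finset.single_le_sum (f := fun m : ℕ × ℕ => |C m.1 m.2|) (fun _ _ => abs_nonneg _) hm))

/-- A Schwartz function is bounded by any negative power of `1 + ‖x‖`. -/
lemma SchwartzMap.exists_one_add_norm_pow_mul_le {E F : Type*}
    [NormedAddCommGroup E] [NormedSpace ℝ E] [NormedAddCommGroup F] [NormedSpace ℝ F]
    (f : 𝓢(E, F)) (k : ℕ) : ∃ C : ℝ, 0 ≤ C ∧ ∀ x, (1 + ‖x‖) ^ k * ‖f x‖ ≤ C := by
  obtain ⟨C, hC, h⟩ := exists_forall_one_add_norm_pow_mul_le (f := fun _ : Unit => f)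
    (K := univ) (fun k n => ⟨_, fun _ _ => le_rfl⟩) k 0
  exact ⟨C, hC, fun x => by simpa using h () (mem_univ _) x⟩

section

variable {N : ℕ}

lemma integrable_const_mul_one_add_norm_rpow (C : ℝ) :
    Integrable fun x : EuclideanSpace ℝ (Fin N) => C * (1 + ‖x‖) ^ (-((N + 1 : ℕ) : ℝ)) :=
  (integrable_one_add_norm (by simp)).const_mul C

lemma le_mul_one_add_norm_rpow_of_pow_mul_le {x : EuclideanSpace ℝ (Fin N)} {a C : ℝ}
    (h : (1 + ‖x‖) ^ (N + 1) * a ≤ C) : a ≤ C * (1 + ‖x‖) ^ (-((N + 1 : ℕ) : ℝ)) := by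
  have hx : 0 < 1 + ‖x‖ := by positivity
  rw [Real.rpow_neg hx.le, Real.rpow_natCast, ← div_eq_mul_inv, le_div_iff₀ (by positivity)]
  linarith

/-- A continuous function dominated by a polynomial times a Schwartz function is integrable. -/
lemma SchwartzMap.integrable_of_norm_le_pow_mul {F G : Type*} [NormedAddCommGroup F]
    [NormedSpace ℝ F] [NormedAddCommGroup G] {h : EuclideanSpace ℝ (Fin N) → G}
    (hc : Continuous h) (f : 𝓢(EuclideanSpace ℝ (Fin N), F)) {C : ℝ} {m : ℕ}
    (hle : ∀ x, ‖h x‖ ≤ C * (1 + ‖x‖) ^ m * ‖f x‖) : Integrable h := by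
  obtain ⟨D, hD, hf⟩ := f.exists_one_add_norm_pow_mul_le (N + 1 + m)
  refine (integrable_const_mul_one_add_norm_rpow (|C| * D)).mono' hc.aestronglyMeasurable
    (.of_forall fun x => le_mul_one_add_norm_rpow_of_pow_mul_le ?_)
  calc (1 + ‖x‖) ^ (N + 1) * ‖h x‖
      ≤ (1 + ‖x‖) ^ (N + 1) * (|C| * (1 + ‖x‖) ^ m * ‖f x‖) := by
        gcongr
        exact (hle x).trans (by gcongr; exact le_abs_self C)
    _ = |C| * ((1 + ‖x‖) ^ (N + 1 + m) * ‖f x‖) := by ring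
    _ ≤ |C| * D := by gcongr; exact hf x

/-- The product of a continuous function of polynomial growth and two Schwartz functions, one of
them conjugated, is integrable. -/
lemma SchwartzMap.integrable_mul_conj_mul {ψ : EuclideanSpace ℝ (Fin N) → ℝ}
    (hψ : Continuous ψ) {C : ℝ} {m : ℕ} (hle : ∀ x, ‖ψ x‖ ≤ C * (1 + ‖x‖) ^ m)
    (f g : 𝓢(EuclideanSpace ℝ (Fin N), ℂ)) :
    Integrable fun x => (ψ x : ℂ) * (starRingEnd ℂ) (f x) * g x := by
  obtain ⟨D, hD, hf⟩ := f.exists_one_add_norm_pow_mul_le 0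
  refine SchwartzMap.integrable_of_norm_le_pow_mul ?_ g (C := C * D) (m := m) fun x => ?_
  · exact ((Complex.continuous_ofReal.comp hψ).mul
      (Complex.continuous_conj.comp f.continuous)).mul g.continuous
  · have h0 : 0 ≤ C * (1 + ‖x‖) ^ m := (norm_nonneg _).trans (hle x)
    rw [norm_mul, norm_mul, Complex.norm_real, RCLike.norm_conj]
    calc ‖ψ x‖ * ‖f x‖ * ‖g x‖ ≤ (C * (1 + ‖x‖) ^ m) * D * ‖g x‖ := by
          gcongr
          · exact hle x
          · simpa using hf x
      _ = C * D * (1 + ‖x‖) ^ m * ‖g x‖ := by ring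

/-- Integrating by parts, the imaginary part of `∫ ψ f̄ ∂²f` loses the term `∫ ψ |∂f|²`. -/
lemma SchwartzMap.im_integral_mul_conj_mul_lineDeriv_lineDeriv
    {ψ : EuclideanSpace ℝ (Fin N) → ℝ} (hψ : ContDiff ℝ 1 ψ) {C : ℝ} {m : ℕ}
    (hle : ∀ x, ‖ψ x‖ ≤ C * (1 + ‖x‖) ^ m) (w : EuclideanSpace ℝ (Fin N))
    (hle' : ∀ x, ‖fderiv ℝ ψ x w‖ ≤ C * (1 + ‖x‖) ^ m)
    (f : 𝓢(EuclideanSpace ℝ (Fin N), ℂ)) :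
    (∫ x, (ψ x : ℂ) * (starRingEnd ℂ) (f x) * (∂_{w} (∂_{w} f)) x).im =
      -(∫ x, ((fderiv ℝ ψ x w : ℝ) : ℂ) * (starRingEnd ℂ) (f x) * (∂_{w} f) x).im := by
  have hψ' : Continuous fun x => fderiv ℝ ψ x w :=
    (hψ.continuous_fderiv one_ne_zero).clm_apply continuous_const
  have i1 := SchwartzMap.integrable_mul_conj_mul hψ' hle' f (∂_{w} f)
  have i2 := SchwartzMap.integrable_mul_conj_mul hψ.continuous hle (∂_{w} f) (∂_{w} f)
  have hibp := integral_bilinear_hasLineDerivAt_right_eq_neg_left_of_integrable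
    (μ := (volume : Measure (EuclideanSpace ℝ (Fin N))))
    (f := fun x => (ψ x : ℂ) * (starRingEnd ℂ) (f x))
    (f' := fun x => ((fderiv ℝ ψ x w : ℝ) : ℂ) * (starRingEnd ℂ) (f x) +
      (ψ x : ℂ) * (starRingEnd ℂ) ((∂_{w} f) x))
    (g := fun x => (∂_{w} f) x) (g' := fun x => (∂_{w} (∂_{w} f)) x) (v := w)
    (B := ContinuousLinearMap.mul ℝ ℂ)
    (by simpa [add_mul, Pi.add_def] using i1.add i2)
    (by simpa using SchwartzMap.integrable_mul_conj_mul hψ.continuous hle f (∂_{w} (∂_{w} f)))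
    (by simpa using SchwartzMap.integrable_mul_conj_mul hψ.continuous hle f (∂_{w} f))
    (fun x _ => by
      have h1 : HasFDerivAt (fun y => (ψ y : ℂ)) (Complex.ofRealCLM ∘L fderiv ℝ ψ x) x :=
        Complex.ofRealCLM.hasFDerivAt.comp x
          ((hψ.differentiable one_ne_zero) x).hasFDerivAt
      have h2 : HasFDerivAt (fun y => (starRingEnd ℂ) (f y))
          ((Complex.conjCLE : ℂ →L[ℝ] ℂ) ∘L fderiv ℝ f x) x :=
        (Complex.conjCLE : ℂ →L[ℝ] ℂ).hasFDerivAt.comp x (f.hasFDerivAt x)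
      convert! (h1.mul h2).hasLineDerivAt w using 1
      simp [SchwartzMap.lineDerivOp_apply_eq_fderiv]
      ring)
    (fun x _ => ((∂_{w} f).hasFDerivAt x).hasLineDerivAt w)
  simp only [ContinuousLinearMap.mul_apply', add_mul] at hibp
  rw [hibp, integral_add i1 i2, Complex.neg_im, Complex.add_im]
  have hreal : (∫ x, (ψ x : ℂ) * (starRingEnd ℂ) ((∂_{w} f) x) * (∂_{w} f) x) =
      ((∫ x, ψ x * ‖(∂_{w} f) x‖ ^ 2 : ℝ) : ℂ) := by
    rw [← integral_complex_ofReal]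
    congr 1 with x
    rw [mul_assoc, Complex.conj_mul']
    push_cast
    rfl
  rw [hreal, Complex.ofReal_im, add_zero]

lemma lap_schwartzMap (f : 𝓢(EuclideanSpace ℝ (Fin N), ℂ)) (x : EuclideanSpace ℝ (Fin N)) :
    lap (fun y => f y) x =
      ∑ i : Fin N, (∂_{EuclideanSpace.single i (1 : ℝ)} (∂_{EuclideanSpace.single i (1 : ℝ)} f) :
        𝓢(EuclideanSpace ℝ (Fin N), ℂ)) x :=
  rfl

lemma norm_lap_schwartzMap_le (f : 𝓢(EuclideanSpace ℝ (Fin N), ℂ))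
    (x : EuclideanSpace ℝ (Fin N)) :
    ‖lap (fun y => f y) x‖ ≤ N * ‖iteratedFDeriv ℝ 2 f x‖ := by
  rw [lap_schwartzMap]
  refine (norm_sum_le_of_le (n := fun _ => ‖iteratedFDeriv ℝ 2 f x‖) _ fun i _ => ?_).trans
    (by simp)
  have h := SchwartzMap.iteratedLineDerivOp_eq_iteratedFDeriv (f := f) (x := x)
    (m := fun _ : Fin 2 => EuclideanSpace.single i (1 : ℝ))
  have h2 : (∂_{EuclideanSpace.single i (1 : ℝ)} (∂_{EuclideanSpace.single i (1 : ℝ)} f)) x =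
      iteratedFDeriv ℝ 2 f x fun _ => EuclideanSpace.single i (1 : ℝ) := h
  rw [h2]
  exact (ContinuousMultilinearMap.le_opNorm _ _).trans (by simp)

end

/-- The nonlinearity drops out of the time derivative of the mass density. -/
lemma INLSSolution.hasDerivWithinAt_norm_sq {N : ℕ} {b p : ℝ} {J : Set ℝ}
    (sol : INLSSolution N b p J) {t : ℝ} (ht : t ∈ J) {x : EuclideanSpace ℝ (Fin N)}
    (hx : x ≠ 0) :
    HasDerivWithinAt (fun s => ‖sol.u s x‖ ^ 2)
      (-2 * ((starRingEnd ℂ) (sol.u t x) * lap (fun y => sol.u t y) x).im) J t := by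
  obtain ⟨d, hd, heq⟩ := sol.eqn t ht x hx
  convert! hd.norm_sq using 1
  generalize ‖x‖ ^ (-b) * ‖sol.u t x‖ ^ (p - 1) = V at heq
  generalize lap (fun y => sol.u t y) x = L at heq
  generalize sol.u t x = z at heq
  have hre := congrArg Complex.re heq
  have him := congrArg Complex.im heq
  simp at hre him
  simp [Complex.inner]
  linear_combination (2 * z.im) * hre - (2 * z.re) * him

lemma integral_virial_identity {N : ℕ} {φ : EuclideanSpace ℝ (Fin N) → ℝ}
    (hφ : ContDiff ℝ 1 φ) {C : ℝ} {m : ℕ} (h0 : ∀ x, ‖φ x‖ ≤ C * (1 + ‖x‖) ^ m)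
    (h1 : ∀ x, ‖fderiv ℝ φ x‖ ≤ C * (1 + ‖x‖) ^ m) (f : 𝓢(EuclideanSpace ℝ (Fin N), ℂ)) :
    ∫ x, φ x * (-2 * ((starRingEnd ℂ) (f x) * lap (fun y => f y) x).im) =
      2 * (∫ x, (∑ i : Fin N, ((fderiv ℝ φ x (EuclideanSpace.single i 1) : ℝ) : ℂ) *
        fderiv ℝ (fun y => f y) x (EuclideanSpace.single i 1)) *
          (starRingEnd ℂ) (f x)).im := by
  have hd (i : Fin N) (x) : ‖fderiv ℝ φ x (EuclideanSpace.single i 1)‖ ≤ C * (1 + ‖x‖) ^ m :=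
    ((fderiv ℝ φ x).le_opNorm _).trans (by simpa using h1 x)
  have hc (i : Fin N) : Continuous fun x => fderiv ℝ φ x (EuclideanSpace.single i 1) :=
    (hφ.continuous_fderiv one_ne_zero).clm_apply continuous_const
  have hint (i : Fin N) := SchwartzMap.integrable_mul_conj_mul hφ.continuous h0 f
    (∂_{EuclideanSpace.single i (1 : ℝ)} (∂_{EuclideanSpace.single i (1 : ℝ)} f))
  have hint' (i : Fin N) := SchwartzMap.integrable_mul_conj_mul (hc i) (hd i) f
    (∂_{EuclideanSpace.single i (1 : ℝ)} f)
  have hL : ∫ x, φ x * (-2 * ((starRingEnd ℂ) (f x) * lap (fun y => f y) x).im) =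
      -2 * (∑ i : Fin N, ∫ x, (φ x : ℂ) * (starRingEnd ℂ) (f x) *
        (∂_{EuclideanSpace.single i (1 : ℝ)} (∂_{EuclideanSpace.single i (1 : ℝ)} f)) x).im := by
    rw [← integral_finsetSum _ fun i _ => hint i]
    have him := integral_im (𝕜 := ℂ) (integrable_finsetSum Finset.univ fun i _ => hint i)
    simp only [RCLike.im_to_complex] at him
    rw [← him, ← integral_const_mul]
    congr 1 with x
    rw [lap_schwartzMap, ← Finset.mul_sum, mul_assoc, Complex.im_ofReal_mul]
    ring
  have hR : (∫ x, (∑ i : Fin N, ((fderiv ℝ φ x (EuclideanSpace.single i 1) : ℝ) : ℂ) *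
        fderiv ℝ (fun y => f y) x (EuclideanSpace.single i 1)) * (starRingEnd ℂ) (f x)) =
      ∑ i : Fin N, ∫ x, ((fderiv ℝ φ x (EuclideanSpace.single i 1) : ℝ) : ℂ) *
        (starRingEnd ℂ) (f x) * (∂_{EuclideanSpace.single i (1 : ℝ)} f) x := by
    rw [← integral_finsetSum _ fun i _ => hint' i]
    congr 1 with x
    rw [Finset.sum_mul]
    refine Finset.sum_congr rfl fun i _ => ?_
    rw [SchwartzMap.lineDerivOp_apply_eq_fderiv]
    ring
  rw [hL, hR, Complex.im_sum, Complex.im_sum, Finset.mul_sum, Finset.mul_sum]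
  refine Finset.sum_congr rfl fun i _ => ?_
  rw [SchwartzMap.im_integral_mul_conj_mul_lineDeriv_lineDeriv hφ h0 _ (hd i) f]
  ring

/-- First derivative of the localized virial quantity: for a classical
Schwartz solution of (INLS) on an interval `J` and a `C⁴` weight `φ` whose derivatives of
order `≤ 4` have polynomial growth, `I(t) = ∫ φ |u(t,·)|² dx` is differentiable on `J` with
`I'(t) = 2 Im ∫ ∇φ·∇u(t) · conj(u(t)) dx`. -/
theorem stmt11 (N : ℕ) (hN : 1 ≤ N) (b p : ℝ) (hb1 : 0 < b) (hb2 : b < min 2 (N : ℝ))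
    (hp : 1 < p) (J : Set ℝ) (hJ : J.OrdConnected) (sol : INLSSolution N b p J)
    (φ : EuclideanSpace ℝ (Fin N) → ℝ) (hφ : ContDiff ℝ 4 φ)
    (hgrowth : ∃ (C : ℝ) (m : ℕ), ∀ x : EuclideanSpace ℝ (Fin N), ∀ k : ℕ, k ≤ 4 →
      ‖iteratedFDeriv ℝ k φ x‖ ≤ C * (1 + ‖x‖) ^ m) :
    ∀ t ∈ J,
      HasDerivWithinAt
        (fun s => ∫ x : EuclideanSpace ℝ (Fin N), φ x * ‖sol.u s x‖ ^ 2)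
        (2 * (∫ x : EuclideanSpace ℝ (Fin N),
          (∑ i : Fin N, ((fderiv ℝ φ x (EuclideanSpace.single i 1) : ℝ) : ℂ) *
              fderiv ℝ (fun y => sol.u t y) x (EuclideanSpace.single i 1)) *
            (starRingEnd ℂ) (sol.u t x)).im)
        J t := by
  intro t ht
  obtain ⟨C, m, hCm⟩ := hgrowth
  have h0 (x) : ‖φ x‖ ≤ C * (1 + ‖x‖) ^ m := by simpa using hCm x 0 (by norm_num)
  have h1 (x) : ‖fderiv ℝ φ x‖ ≤ C * (1 + ‖x‖) ^ m := by
    simpa [norm_iteratedFDeriv_one] using hCm x 1 (by norm_num)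
  have hφ1 : ContDiff ℝ 1 φ := hφ.of_le (by norm_num)
  obtain ⟨a, c, htK, hKJ, hKt⟩ := hJ.exists_Icc_mem_nhdsWithin ht
  rw [← integral_virial_identity hφ1 h0 h1 (sol.u t)]
  obtain ⟨D₀, hD₀, hu⟩ := SchwartzMap.exists_forall_one_add_norm_pow_mul_le
    (sol.seminorm_bound _ hKJ isCompact_Icc) 0 0
  obtain ⟨D₂, hD₂, hlap⟩ := SchwartzMap.exists_forall_one_add_norm_pow_mul_le
    (sol.seminorm_bound _ hKJ isCompact_Icc) (N + 1 + m) 2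
  have : Nonempty (Fin N) := ⟨⟨0, hN⟩⟩
  have hae : ∀ᵐ x : EuclideanSpace ℝ (Fin N), x ≠ 0 :=
    compl_mem_ae_iff.2 (measure_singleton 0)
  refine HasDerivWithinAt.mono_of_mem_nhdsWithin ?_ hKt
  refine hasDerivWithinAt_integral_of_dominated
    (F' := fun s x => φ x *
      (-2 * ((starRingEnd ℂ) (sol.u s x) * lap (fun y => sol.u s y) x).im))
    (convex_Icc a c) htK (fun s _ => ?_)
    (integrable_const_mul_one_add_norm_rpow (2 * |C| * D₀ * N * D₂)) ?_
  · have h := (SchwartzMap.integrable_mul_conj_mul hφ1.continuous h0 (sol.u s) (sol.u s)).re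
    refine h.congr (.of_forall fun x => ?_)
    simp only [RCLike.re_to_complex]
    rw [mul_assoc, Complex.conj_mul', Complex.re_ofReal_mul]
    norm_cast
  · filter_upwards [hae] with x hx s hs
    refine ⟨((sol.hasDerivWithinAt_norm_sq (hKJ hs) hx).mono hKJ).const_mul (φ x),
      le_mul_one_add_norm_rpow_of_pow_mul_le ?_⟩
    have hu' : ‖sol.u s x‖ ≤ D₀ := by simpa using hu s hs x
    have him : |((starRingEnd ℂ) (sol.u s x) * lap (fun y => sol.u s y) x).im| ≤
        D₀ * (N * ‖iteratedFDeriv ℝ 2 (sol.u s) x‖) := by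
      refine (Complex.abs_im_le_norm _).trans ?_
      rw [norm_mul, RCLike.norm_conj]
      exact mul_le_mul hu' (norm_lap_schwartzMap_le _ x) (norm_nonneg _) hD₀
    rw [norm_mul, norm_mul, norm_neg, Real.norm_ofNat, Real.norm_eq_abs (Complex.im _)]
    calc (1 + ‖x‖) ^ (N + 1) * (‖φ x‖ * (2 *
          |((starRingEnd ℂ) (sol.u s x) * lap (fun y => sol.u s y) x).im|))
        ≤ (1 + ‖x‖) ^ (N + 1) * ((|C| * (1 + ‖x‖) ^ m) * (2 *
          (D₀ * (N * ‖iteratedFDeriv ℝ 2 (sol.u s) x‖)))) := by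
          gcongr
          exact (h0 x).trans (by gcongr; exact le_abs_self C)
      _ = 2 * |C| * D₀ * N * ((1 + ‖x‖) ^ (N + 1 + m) *
          ‖iteratedFDeriv ℝ 2 (sol.u s) x‖) := by ring
      _ ≤ 2 * |C| * D₀ * N * D₂ := by gcongr; exact hlap s hs x
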